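/- Let f(x,y) = 22x² + 36xy + 24y² − 80x³ − 10x²y + 71xy² + 39y³ + 15x⁴ + 4x³y − 3x²y² − 21xy³ − 17y⁴. Then the hessian curve Z = {(x,y) ∈ ℝ² : Hess(f)(x,y) = 0} has exactly 5 connected components, of which exactly 3 are bounded subsets of ℝ² (ovals) and exactly 2 are unbounded. -/

import Mathlib

open MvPolynomial

/-- The hessian determinant of a polynomial in two variables over the reals:
`Hess f = f_xx * f_yy - f_xy ^ 2` (with formal partial derivatives). -/
noncomputable def Hess (f : MvPolynomial (Fin 2) ℝ) : MvPolynomial (Fin 2) ℝ :=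
  pderiv 0 (pderiv 0 f) * pderiv 1 (pderiv 1 f) - (pderiv 0 (pderiv 1 f)) ^ 2

/-- The set of connected components of a set `Z ⊆ ℝ × ℝ` (with its subspace
topology), viewed as subsets of `ℝ × ℝ`. -/
def components (Z : Set (ℝ × ℝ)) : Set (Set (ℝ × ℝ)) :=
  {C | ∃ p ∈ Z, C = connectedComponentIn Z p}

/-- The polynomial `f` of the statement. -/
noncomputable def f : MvPolynomial (Fin 2) ℝ :=
  22 * (X 0)^2 + 36 * (X 0)*(X 1) + 24 * (X 1)^2 - 80 * (X 0)^3 - 10 * (X 0)^2*(X 1) + 71 * (X 0)*(X 1)^2 + 39 * (X 1)^3 + 15 * (X 0)^4 + 4 * (X 0)^3*(X 1) - 3 * (X 0)^2*(X 1)^2 - 21 * (X 0)*(X 1)^3 - 17 * (X 1)^4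

/-- The hessian curve of `f` in `ℝ²`. -/
noncomputable def Z : Set (ℝ × ℝ) := {p | eval ![p.1, p.2] (Hess f) = 0}

open Set Filter Topology

noncomputable section

namespace HessianCurve

/-! ### Zero sets crossed once by a family of lines -/

/-- A function which is positive at `a`, negative at a later point `b`, and decreasing at each of
its zeros changes sign exactly once after `a`. -/
theorem exists_unique_sign_change {g g' : ℝ → ℝ} {J : Set ℝ} (hJ : J.OrdConnected) {a b : ℝ}
    (ha : a ∈ J) (hb : b ∈ J) (hab : a ≤ b) (hg : ∀ t, HasDerivAt g (g' t) t)
    (hga : 0 < g a) (hgb : g b < 0) (hneg : ∀ t ∈ J, g t = 0 → g' t < 0) :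
    ∃ r ∈ J, a < r ∧ g r = 0 ∧ ∀ t ∈ J, a ≤ t → (t < r → 0 < g t) ∧ (r < t → g t < 0) := by
  have hcont : Continuous g := continuous_iff_continuousAt.2 fun t => (hg t).continuousAt
  have after_zero : ∀ s ∈ J, g s = 0 → ∀ t ∈ J, s < t → g t < 0 := by
    intro s hs hgs t ht hst
    have hle : ∀ x ∈ Icc s t, g x ≤ 0 := by
      intro x hx
      refine image_le_of_deriv_right_lt_deriv_boundary (f' := g') (B := fun _ => 0)
        (B' := fun _ => 0) hcont.continuousOn (fun x _ => (hg x).hasDerivWithinAt) hgs.le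
        (fun x => hasDerivAt_const x 0) (fun x hx hgx => ?_) hx
      exact hneg x (hJ.out hs ht ⟨hx.1, hx.2.le⟩) hgx
    refine lt_of_le_of_ne (hle t ⟨hst.le, le_rfl⟩) fun hgt => ?_
    have hd : deriv g t < 0 := by rw [(hg t).deriv]; exact hneg t ht hgt
    obtain ⟨x, hx, hxs, hxt⟩ := ((eventually_nhdsWithin_sign_eq_of_deriv_neg hd hgt).filter_mono
      nhdsWithin_le_nhds |>.and (Ioo_mem_nhdsLT hst)).exists
    rw [sign_pos (sub_pos.2 hxt), sign_eq_one_iff] at hx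
    exact (hle x ⟨hxs.le, hxt.le⟩).not_gt hx
  obtain ⟨r, hr, hgr⟩ := intermediate_value_Icc' hab hcont.continuousOn ⟨hgb.le, hga.le⟩
  have hrJ : r ∈ J := hJ.out ha hb hr
  have har : a < r := lt_of_le_of_ne hr.1 (by rintro rfl; exact hga.ne' hgr)
  refine ⟨r, hrJ, har, hgr, fun t ht hat => ⟨fun htr => ?_, after_zero r hrJ hgr t ht⟩⟩
  by_contra! hgt
  obtain ⟨s, hs, hgs⟩ := intermediate_value_Icc' hat hcont.continuousOn ⟨hgt, hga.le⟩
  exact (after_zero s (hJ.out ha ht hs) hgs r hrJ (hs.2.trans_lt htr)).ne hgr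

/-- If on each vertical fibre of an open set `V` a continuous function changes sign exactly once,
then its zero set in `V` is the graph of a continuous function. -/
theorem exists_continuous_graph {g : ℝ × ℝ → ℝ} (hg : Continuous g) {V : Set (ℝ × ℝ)}
    (hV : IsOpen V) (hVc : ∀ θ, {t | (θ, t) ∈ V}.OrdConnected)
    (h : ∀ θ, ∃ r, (θ, r) ∈ V ∧ g (θ, r) = 0 ∧
      ∀ t, (θ, t) ∈ V → (t < r → 0 < g (θ, t)) ∧ (r < t → g (θ, t) < 0)) :
    ∃ r : ℝ → ℝ, Continuous r ∧ ∀ θ t, (θ, t) ∈ V ∧ g (θ, t) = 0 ↔ t = r θ := by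
  choose r hrV hr0 hr using h
  have unique : ∀ θ t, (θ, t) ∈ V ∧ g (θ, t) = 0 ↔ t = r θ := by
    refine fun θ t => ⟨fun ⟨htV, ht⟩ => ?_, fun ht => ht ▸ ⟨hrV θ, hr0 θ⟩⟩
    rcases lt_trichotomy t (r θ) with hlt | heq | hgt
    · exact absurd ht ((hr θ t htV).1 hlt).ne'
    · exact heq
    · exact absurd ht ((hr θ t htV).2 hgt).ne
  refine ⟨r, continuous_iff_continuousAt.2 fun θ => Metric.continuousAt_iff'.2 fun ε hε => ?_,
    unique⟩
  have hmem : ∀ᶠ t in 𝓝 (r θ), (θ, t) ∈ V :=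
    (Continuous.prodMk_right θ).continuousAt.eventually (hV.mem_nhds (hrV θ))
  obtain ⟨δ, hδ, hball⟩ := Metric.eventually_nhds_iff.1 hmem
  set η := min δ ε / 2 with hη
  have hη0 : 0 < η := by positivity
  have hηδ : η < δ := by have := min_le_left δ ε; have := lt_min hδ hε; linarith
  have hηε : η < ε := by have := min_le_right δ ε; have := lt_min hδ hε; linarith
  have hlowV : (θ, r θ - η) ∈ V := hball (by simpa [Real.dist_eq, abs_of_pos hη0])
  have hhighV : (θ, r θ + η) ∈ V := hball (by simpa [Real.dist_eq, abs_of_pos hη0])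
  have hlow := (hr θ _ hlowV).1 (by linarith)
  have hhigh := (hr θ _ hhighV).2 (by linarith)
  have hslice : ∀ t : ℝ, ContinuousAt (fun θ' : ℝ => (θ', t)) θ := fun t =>
    (Continuous.prodMk_left t).continuousAt
  filter_upwards [(hslice _).eventually (hV.mem_nhds hlowV),
    (hslice _).eventually (hV.mem_nhds hhighV),
    (hslice _).eventually (hg.continuousAt.eventually_const_lt hlow),
    (hslice _).eventually (hg.continuousAt.eventually_lt_const hhigh)] with θ' h1 h2 h3 h4
  obtain ⟨t, ht, hgt⟩ := intermediate_value_Icc' (f := fun t => g (θ', t))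
    (by linarith : r θ - η ≤ r θ + η) (by fun_prop) ⟨h4.le, h3.le⟩
  rw [← (unique θ' t).1 ⟨(hVc θ').out h1 h2 ht, hgt⟩, Real.dist_eq, abs_lt]
  constructor <;> linarith [ht.1, ht.2]

/-- The zero set of a function on a convex compact set is connected if the function is positive at
an interior point `p`, negative on the boundary, and radially decreasing from `p` at its zeros. -/
theorem isConnected_zeros_of_radial {F : ℝ × ℝ → ℝ} {F' : ℝ × ℝ → ℝ × ℝ →L[ℝ] ℝ}
    (hF : ∀ q, HasFDerivAt F (F' q) q) {K : Set (ℝ × ℝ)} (hK : Convex ℝ K) (hKc : IsCompact K)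
    {p : ℝ × ℝ} (hp : p ∈ interior K) (hFp : 0 < F p)
    (hboundary : ∀ q ∈ K, q ∉ interior K → F q < 0)
    (hradial : ∀ q ∈ K, F q = 0 → F' q (q - p) < 0) :
    IsConnected {q | q ∈ interior K ∧ F q = 0} := by
  have hFc : Continuous F := continuous_iff_continuousAt.2 fun q => (hF q).continuousAt
  let e : ℝ → ℝ × ℝ := fun θ => (Real.cos θ, Real.sin θ)
  let φ : ℝ × ℝ → ℝ × ℝ := fun z => p + z.2 • e z.1
  have hφ : Continuous φ := by fun_prop
  have he : ∀ θ, e θ ≠ 0 := by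
    intro θ h0
    have h1 : Real.cos θ = 0 := congrArg Prod.fst h0
    have h2 : Real.sin θ = 0 := congrArg Prod.snd h0
    have := Real.sin_sq_add_cos_sq θ
    simp [h1, h2] at this
  have hφθ : ∀ θ, Continuous fun t => φ (θ, t) := fun θ => by fun_prop
  have hline : ∀ θ, (fun t => φ (θ, t)) = AffineMap.lineMap p (p + e θ) := by
    intro θ; ext t <;> simp [φ, AffineMap.lineMap_apply, add_comm]
  have hconv : ∀ θ (S : Set (ℝ × ℝ)), Convex ℝ S → {t : ℝ | φ (θ, t) ∈ S}.OrdConnected := by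
    intro θ S hS
    have := (hS.affine_preimage (AffineMap.lineMap p (p + e θ))).ordConnected
    rw [← hline] at this
    exact this
  obtain ⟨r, hr, hgraph⟩ := exists_continuous_graph (hFc.comp hφ)
    (V := {z | 0 < z.2 ∧ φ z ∈ interior K})
    ((isOpen_lt continuous_const continuous_snd).inter (isOpen_interior.preimage hφ))
    (fun θ => ordConnected_Ioi.inter (hconv θ _ hK.interior)) (fun θ => by
      have hJ : IsCompact {t : ℝ | 0 ≤ t ∧ φ (θ, t) ∈ K} := by
        refine Metric.isCompact_of_isClosed_isBounded
          (isClosed_Ici.inter (hKc.isClosed.preimage (hφθ θ))) ?_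
        obtain ⟨C, hC⟩ := hKc.isBounded.exists_norm_le
        refine (Metric.isBounded_Icc 0 ((C + ‖p‖) / ‖e θ‖)).subset fun t ⟨ht0, ht⟩ => ⟨ht0, ?_⟩
        rw [le_div_iff₀ (norm_pos_iff.2 (he θ))]
        calc t * ‖e θ‖ = ‖φ (θ, t) - p‖ := by simp [φ, norm_smul, abs_of_nonneg ht0]
          _ ≤ ‖φ (θ, t)‖ + ‖p‖ := norm_sub_le _ _
          _ ≤ C + ‖p‖ := by gcongr; exact hC _ ht
      have h0 : φ (θ, 0) = p := by simp [φ]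
      have h0J : (0 : ℝ) ∈ {t : ℝ | 0 ≤ t ∧ φ (θ, t) ∈ K} :=
        ⟨le_rfl, by rw [h0]; exact interior_subset hp⟩
      obtain ⟨τ, ⟨hτ0, hτK⟩, hτ⟩ := hJ.exists_isGreatest ⟨0, h0J⟩
      have hτneg : F (φ (θ, τ)) < 0 := by
        refine hboundary _ hτK fun hint => ?_
        have hev : ∀ᶠ t in 𝓝 τ, φ (θ, t) ∈ interior K :=
          (hφθ θ).continuousAt.eventually (isOpen_interior.mem_nhds hint)
        obtain ⟨t, ht, hτt⟩ := ((hev.filter_mono nhdsWithin_le_nhds).and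
          (self_mem_nhdsWithin (s := Ioi τ))).exists
        exact (hτ ⟨hτ0.trans (le_of_lt hτt), interior_subset ht⟩).not_gt hτt
      have hderiv : ∀ t, HasDerivAt (fun t => F (φ (θ, t))) (F' (φ (θ, t)) (e θ)) t := fun t =>
        (hF _).comp_hasDerivAt t (by
          have := ((hasDerivAt_id t).smul_const (e θ)).const_add p
          simp only [id, one_smul] at this
          exact this)
      obtain ⟨ρ, ⟨hρ0, hρK⟩, hρpos, hρ, hsign⟩ := exists_unique_sign_change
        (J := {t : ℝ | 0 ≤ t ∧ φ (θ, t) ∈ K})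
        (ordConnected_Ici.inter (hconv θ _ hK)) h0J ⟨hτ0, hτK⟩ hτ0 hderiv (by rwa [h0]) hτneg
        (fun t ⟨ht0, htK⟩ ht => by
          have hrad := hradial _ htK ht
          have : φ (θ, t) - p = t • e θ := by simp [φ]
          rw [this, map_smul, smul_eq_mul] at hrad
          exact neg_of_mul_neg_right hrad ht0)
      refine ⟨ρ, ⟨hρpos, ?_⟩, hρ, fun t ⟨ht0, ht⟩ =>
        hsign t ⟨ht0.le, interior_subset ht⟩ ht0.le⟩
      by_contra hnot
      exact (hboundary _ hρK hnot).ne hρ)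
  have himage : {q | q ∈ interior K ∧ F q = 0} = range fun θ => φ (θ, r θ) := by
    ext q
    constructor
    · rintro ⟨hqK, hq⟩
      let z : ℂ := ⟨q.1 - p.1, q.2 - p.2⟩
      have hpolar : φ (z.arg, ‖z‖) = q := by
        ext
        · simp [φ, e, z, Complex.norm_mul_cos_arg]
        · simp [φ, e, z, Complex.norm_mul_sin_arg]
      have hz : 0 < ‖z‖ := by
        refine norm_pos_iff.2 fun hz => ?_
        rw [hz] at hpolar
        have : p = q := by simpa [φ] using hpolar
        exact hFp.ne' (this ▸ hq)
      refine ⟨z.arg, ?_⟩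
      beta_reduce
      rw [← (hgraph z.arg ‖z‖).1 ⟨⟨hz, by rwa [hpolar]⟩, by simpa [hpolar] using hq⟩]
      exact hpolar
    · rintro ⟨θ, rfl⟩
      obtain ⟨⟨-, h1⟩, h2⟩ := (hgraph θ (r θ)).2 rfl
      exact ⟨h1, h2⟩
  rw [himage]
  exact isConnected_range (hφ.comp (continuous_id.prodMk hr))

/-- The zero set of a function in an open half-plane is connected and unbounded if the function is
negative on the boundary line, eventually positive along all rays of a fixed direction transverse
to that line, and increasing in that direction at its zeros. -/
theorem isConnected_zeros_of_parallel {F : ℝ × ℝ → ℝ} {F' : ℝ × ℝ → ℝ × ℝ →L[ℝ] ℝ}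
    (hF : ∀ q, HasFDerivAt F (F' q) q) {σ m x₀ : ℝ} (hσ : σ * σ = 1)
    (hline : ∀ y, F (x₀, y) < 0) (hfar : ∀ y, ∃ t, 0 ≤ t ∧ 0 < F (x₀ + σ * t, y + m * t))
    (hmono : ∀ q : ℝ × ℝ, 0 ≤ σ * (q.1 - x₀) → F q = 0 → 0 < F' q (σ, m)) :
    IsConnected {q : ℝ × ℝ | 0 < σ * (q.1 - x₀) ∧ F q = 0} ∧
      ¬ Bornology.IsBounded {q : ℝ × ℝ | 0 < σ * (q.1 - x₀) ∧ F q = 0} := by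
  have hFc : Continuous F := continuous_iff_continuousAt.2 fun q => (hF q).continuousAt
  let φ : ℝ × ℝ → ℝ × ℝ := fun z => (x₀ + σ * z.2, z.1 + m * z.2)
  have hφ : Continuous φ := by fun_prop
  have hside : ∀ z, σ * ((φ z).1 - x₀) = z.2 := by
    intro z
    calc σ * ((φ z).1 - x₀) = σ * σ * z.2 := by simp only [φ]; ring
      _ = z.2 := by rw [hσ, one_mul]
  obtain ⟨r, hr, hgraph⟩ := exists_continuous_graph (g := fun z => -F (φ z)) (by fun_prop)
    (V := {z | 0 < z.2}) (isOpen_lt continuous_const continuous_snd)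
    (fun θ => ordConnected_Ioi) (fun θ => by
      obtain ⟨τ, hτ0, hτ⟩ := hfar θ
      have hderiv : ∀ t, HasDerivAt (fun t => -F (φ (θ, t))) (-F' (φ (θ, t)) (σ, m)) t :=
        fun t => ((hF _).comp_hasDerivAt t (by
          have h1 := ((hasDerivAt_id t).const_mul σ).const_add x₀
          have h2 := ((hasDerivAt_id t).const_mul m).const_add θ
          simpa using h1.prodMk h2)).neg
      obtain ⟨ρ, -, hρpos, hρ, hsign⟩ := exists_unique_sign_change (J := Ici 0)
        ordConnected_Ici self_mem_Ici (mem_Ici.2 hτ0) hτ0 hderiv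
        (by simpa [φ] using hline θ) (by simpa [φ] using hτ)
        (fun t ht ht0 => by
          simpa using hmono (φ (θ, t)) (by rw [hside]; exact ht) (by simpa using ht0))
      exact ⟨ρ, hρpos, hρ, fun t ht => hsign t (mem_Ici.2 (le_of_lt ht)) (le_of_lt ht)⟩)
  have hmem : ∀ θ, φ (θ, r θ) ∈ {q : ℝ × ℝ | 0 < σ * (q.1 - x₀) ∧ F q = 0} := by
    intro θ
    obtain ⟨h1, h2⟩ := (hgraph θ (r θ)).2 rfl
    exact ⟨by rw [hside]; exact h1, by simpa using h2⟩
  constructor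
  · have himage : {q : ℝ × ℝ | 0 < σ * (q.1 - x₀) ∧ F q = 0} = range fun θ => φ (θ, r θ) := by
      refine Subset.antisymm (fun q ⟨hq, hFq⟩ => ?_) (range_subset_iff.2 hmem)
      let t := σ * (q.1 - x₀)
      have hq' : φ (q.2 - m * t, t) = q := by
        ext
        · calc x₀ + σ * (σ * (q.1 - x₀)) = x₀ + σ * σ * (q.1 - x₀) := by ring
            _ = q.1 := by rw [hσ]; ring
        · simp [φ]
      refine ⟨q.2 - m * t, ?_⟩
      beta_reduce
      rw [← (hgraph (q.2 - m * t) t).1 ⟨hq, by simpa [hq'] using hFq⟩]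
      exact hq'
    rw [himage]
    exact isConnected_range (hφ.comp (continuous_id.prodMk hr))
  · intro hb
    have hc : Continuous fun q : ℝ × ℝ => q.2 - m * (σ * (q.1 - x₀)) := by fun_prop
    obtain ⟨C, hC⟩ := (hb.isCompact_closure.image hc).isBounded.exists_norm_le
    have h1 : ‖(φ (|C| + 1, r (|C| + 1))).2 - m * (σ * ((φ (|C| + 1, r (|C| + 1))).1 - x₀))‖ ≤ C :=
      hC _ (mem_image_of_mem _ (subset_closure (hmem (|C| + 1))))
    rw [hside] at h1
    simp only [φ, add_sub_cancel_right, Real.norm_eq_abs] at h1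
    have := le_abs_self C
    rw [abs_of_pos (by positivity)] at h1
    linarith

/-! ### The homogenised hessian -/

/-- The homogenisation of `f_xx`. -/
def homXX (x y z : ℝ) : ℝ :=
  44 * z ^ 2 - 480 * x * z - 20 * y * z + 180 * x ^ 2 + 24 * x * y - 6 * y ^ 2

/-- The homogenisation of `f_yy`. -/
def homYY (x y z : ℝ) : ℝ :=
  48 * z ^ 2 + 142 * x * z + 234 * y * z - 6 * x ^ 2 - 126 * x * y - 204 * y ^ 2

/-- The homogenisation of `f_xy`. -/
def homXY (x y z : ℝ) : ℝ :=
  36 * z ^ 2 - 20 * x * z + 142 * y * z + 12 * x ^ 2 - 12 * x * y - 63 * y ^ 2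

/-- The homogenisation of the hessian determinant of `f`. -/
def homHess (x y z : ℝ) : ℝ := homXX x y z * homYY x y z - homXY x y z ^ 2

/-- The derivative of `homHess` in its first variable. -/
def homHessX (x y z : ℝ) : ℝ :=
  (360 * x + 24 * y - 480 * z) * homYY x y z + homXX x y z * (142 * z - 12 * x - 126 * y)
    - 2 * homXY x y z * (24 * x - 12 * y - 20 * z)

/-- The derivative of `homHess` in its second variable. -/
def homHessY (x y z : ℝ) : ℝ :=
  (24 * x - 12 * y - 20 * z) * homYY x y z + homXX x y z * (234 * z - 126 * x - 408 * y)
    - 2 * homXY x y z * (142 * z - 12 * x - 126 * y)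

/-- A form whose nonnegativity certifies `homHess ≤ -1` on `z = 1`. -/
def negForm (x y z : ℝ) : ℝ := -homHess x y z - z ^ 4

/-- A form whose nonnegativity certifies that, on `z = 1`, the radial derivative of `homHess` from
the point `(p, q)` is negative at the zeros of `homHess`. -/
def radialForm (p q x y z : ℝ) : ℝ :=
  homHess x y z - ((x - p * z) * homHessX x y z + (y - q * z) * homHessY x y z) - z ^ 4

/-- A form whose nonnegativity certifies that, on `z = 1`, the derivative of `homHess` in the
direction `(1, -3 / 10)` has the sign of `x - c` at the zeros of `homHess`. -/
def shearForm (c x y z : ℝ) : ℝ :=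
  (x - c * z) * (homHessX x y z - 3 / 10 * homHessY x y z) - 2 * homHess x y z - z ^ 4

/-! ### Covering a cone by positivity regions of two forms -/

/-- The midpoint of two points of `ℝ³`. -/
def mid (a b : ℝ × ℝ × ℝ) : ℝ × ℝ × ℝ :=
  ((a.1 + b.1) / 2, (a.2.1 + b.2.1) / 2, (a.2.2 + b.2.2) / 2)

/-- At every point of the cone spanned by `a`, `b`, `c`, one of `P` and `Q` is nonnegative. -/
def CoverCone (P Q : ℝ → ℝ → ℝ → ℝ) (a b c : ℝ × ℝ × ℝ) : Prop :=
  ∀ u v w : ℝ, 0 ≤ u → 0 ≤ v → 0 ≤ w →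
    0 ≤ P (u * a.1 + v * b.1 + w * c.1) (u * a.2.1 + v * b.2.1 + w * c.2.1)
      (u * a.2.2 + v * b.2.2 + w * c.2.2) ∨
    0 ≤ Q (u * a.1 + v * b.1 + w * c.1) (u * a.2.1 + v * b.2.1 + w * c.2.1)
      (u * a.2.2 + v * b.2.2 + w * c.2.2)

theorem exists_unit_param {a b x : ℝ} (hab : a < b) (hx : x ∈ Set.Icc a b) :
    ∃ s, 0 ≤ s ∧ s ≤ 1 ∧ a + s * (b - a) = x := by
  have hab' : 0 < b - a := sub_pos.2 hab
  refine ⟨(x - a) / (b - a), div_nonneg (sub_nonneg.2 hx.1) hab'.le,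
    (div_le_one hab').2 (by linarith [hx.2]), ?_⟩
  rw [div_mul_cancel₀ _ hab'.ne', add_sub_cancel]

namespace CoverCone

variable {P Q : ℝ → ℝ → ℝ → ℝ} {a b c : ℝ × ℝ × ℝ}

theorem left (h : ∀ u v w : ℝ, 0 ≤ u → 0 ≤ v → 0 ≤ w →
    0 ≤ P (u * a.1 + v * b.1 + w * c.1) (u * a.2.1 + v * b.2.1 + w * c.2.1)
      (u * a.2.2 + v * b.2.2 + w * c.2.2)) : CoverCone P Q a b c :=
  fun u v w hu hv hw => .inl (h u v w hu hv hw)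

theorem right (h : ∀ u v w : ℝ, 0 ≤ u → 0 ≤ v → 0 ≤ w →
    0 ≤ Q (u * a.1 + v * b.1 + w * c.1) (u * a.2.1 + v * b.2.1 + w * c.2.1)
      (u * a.2.2 + v * b.2.2 + w * c.2.2)) : CoverCone P Q a b c :=
  fun u v w hu hv hw => .inr (h u v w hu hv hw)

theorem rotate (h : CoverCone P Q a b c) : CoverCone P Q b c a := by
  intro u v w hu hv hw
  convert h w u v hw hu hv using 3 <;> ring

theorem split₁₂ (h₁ : CoverCone P Q a (mid a b) c) (h₂ : CoverCone P Q (mid a b) b c) :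
    CoverCone P Q a b c := by
  intro u v w hu hv hw
  rcases le_total v u with h | h
  · convert h₁ (u - v) (2 * v) w (by linarith) (by linarith) hw using 3 <;>
      simp only [mid] <;> ring
  · convert h₂ (2 * u) (v - u) w (by linarith) (by linarith) hw using 3 <;>
      simp only [mid] <;> ring

theorem split₂₃ (h₁ : CoverCone P Q a b (mid b c)) (h₂ : CoverCone P Q a (mid b c) c) :
    CoverCone P Q a b c :=
  (split₁₂ h₁.rotate h₂.rotate).rotate.rotate

theorem split₁₃ (h₁ : CoverCone P Q a b (mid a c)) (h₂ : CoverCone P Q (mid a c) b c) :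
    CoverCone P Q a b c := by
  intro u v w hu hv hw
  rcases le_total w u with h | h
  · convert h₁ (u - w) v (2 * w) (by linarith) hv (by linarith) using 3 <;>
      simp only [mid] <;> ring
  · convert h₂ (2 * u) v (w - u) (by linarith) hv (by linarith) using 3 <;>
      simp only [mid] <;> ring

/-- Two triangles sharing a diagonal cover a rectangle. -/
theorem of_rectangle {x₁ x₂ y₁ y₂ : ℝ} (hx : x₁ < x₂) (hy : y₁ < y₂)
    (h₁ : CoverCone P Q (x₁, y₁, 1) (x₂, y₁, 1) (x₂, y₂, 1))
    (h₂ : CoverCone P Q (x₁, y₁, 1) (x₁, y₂, 1) (x₂, y₂, 1)) {x y : ℝ}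
    (hxm : x ∈ Set.Icc x₁ x₂) (hym : y ∈ Set.Icc y₁ y₂) : 0 ≤ P x y 1 ∨ 0 ≤ Q x y 1 := by
  obtain ⟨s, hs0, hs1, rfl⟩ := exists_unit_param hx hxm
  obtain ⟨t, ht0, ht1, rfl⟩ := exists_unit_param hy hym
  rcases le_total t s with h | h
  · convert h₁ (1 - s) (s - t) t (by linarith) (by linarith) ht0 using 3 <;> ring
  · convert h₂ (1 - t) (t - s) s (by linarith) (by linarith) hs0 using 3 <;> ring

/-- The cone over a segment at height `1` and a point at infinity covers a vertical strip. -/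
theorem of_strip {x₁ x₂ y₀ e : ℝ} (hx : x₁ < x₂) (he : e * e = 1)
    (h : CoverCone P Q (x₁, y₀, 1) (x₂, y₀, 1) (0, e, 0)) {x y : ℝ}
    (hxm : x ∈ Set.Icc x₁ x₂) (hy : 0 ≤ e * (y - y₀)) : 0 ≤ P x y 1 ∨ 0 ≤ Q x y 1 := by
  obtain ⟨s, hs0, hs1, rfl⟩ := exists_unit_param hx hxm
  convert h (1 - s) s (e * (y - y₀)) (by linarith) hs0 hy using 3
  all_goals first | ring1 | linear_combination (y₀ - y) * he

/-- Two cones, over a point at height `1` and two points at infinity each, cover a half-plane. -/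
theorem of_halfplane {x₀ σ m : ℝ} (hσ : σ * σ = 1)
    (h₁ : CoverCone P Q (x₀, 0, 1) (σ, m, 0) (0, 1, 0))
    (h₂ : CoverCone P Q (x₀, 0, 1) (σ, m, 0) (0, -1, 0)) {x y : ℝ}
    (hx : 0 ≤ σ * (x - x₀)) : 0 ≤ P x y 1 ∨ 0 ≤ Q x y 1 := by
  rcases le_total 0 (y - m * (σ * (x - x₀))) with h | h
  · convert h₁ 1 (σ * (x - x₀)) _ zero_le_one hx h using 3
    all_goals first | ring1 | linear_combination (x₀ - x) * hσ
  · convert h₂ 1 (σ * (x - x₀)) _ zero_le_one hx (neg_nonneg.2 h) using 3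
    all_goals first | ring1 | linear_combination (x₀ - x) * hσ

/-- Two degenerate cones, over a point at height `1` and a point at infinity, cover a vertical
line. -/
theorem of_line {x₀ : ℝ} (h₁ : CoverCone P Q (x₀, 0, 1) (0, 1, 0) (0, 0, 0))
    (h₂ : CoverCone P Q (x₀, 0, 1) (0, -1, 0) (0, 0, 0)) (y : ℝ) :
    0 ≤ P x₀ y 1 ∨ 0 ≤ Q x₀ y 1 := by
  rcases le_total 0 y with h | h
  · convert h₁ 1 y 0 zero_le_one h le_rfl using 3 <;> ring
  · convert h₂ 1 (-y) 0 zero_le_one (neg_nonneg.2 h) le_rfl using 3 <;> ring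

/-- A degenerate cone over a segment at height `1` covers that segment. -/
theorem of_segment {x₁ x₂ y₀ : ℝ} (hx : x₁ < x₂)
    (h : CoverCone P Q (x₁, y₀, 1) (x₂, y₀, 1) (0, 0, 0)) {x : ℝ} (hxm : x ∈ Set.Icc x₁ x₂) :
    0 ≤ P x y₀ 1 ∨ 0 ≤ Q x y₀ 1 := by
  obtain ⟨s, hs0, hs1, rfl⟩ := exists_unit_param hx hxm
  convert h (1 - s) s 0 (by linarith) hs0 le_rfl using 3 <;> ring

end CoverCone

/-! ### Certificates -/

set_option maxHeartbeats 400000 in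
theorem cover_middle_below :
    CoverCone negForm (radialForm (-3 / 5) (3 / 5))
      (-3, -1 / 4, 1) (5 / 2, -1 / 4, 1) (5 / 2, 5 / 4, 1) := by
  refine .split₁₃ (.split₁₂ (.right ?_) (.split₁₂ (.split₂₃ (.split₁₂ (.split₁₃ (.split₁₂ (.right
    ?_) (.split₂₃ (.split₁₂ (.split₁₃ (.split₁₂ (.split₁₃ (.split₁₂ (.split₁₃ (.split₁₂ (.left ?_)
    (.left ?_)) (.left ?_)) (.left ?_)) (.left ?_)) (.left ?_)) (.left ?_)) (.left ?_)) (.right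
    ?_))) (.left ?_)) (.left ?_)) (.split₁₂ (.right ?_) (.right ?_))) (.split₂₃ (.left ?_) (.right
    ?_)))) (.split₁₃ (.split₁₃ (.split₁₂ (.right ?_) (.left ?_)) (.left ?_)) (.left ?_))
  all_goals
    intro u v w hu hv hw
    simp only [negForm, radialForm, homHess, homHessX, homHessY, homXX, homXY, homYY, mid]
    ring_nf
    positivity

theorem cover_middle_above :
    CoverCone negForm (radialForm (-3 / 5) (3 / 5))
      (-3, -1 / 4, 1) (-3, 5 / 4, 1) (5 / 2, 5 / 4, 1) := by
  refine .split₁₃ (.right ?_) (.split₂₃ (.split₁₂ (.right ?_) (.right ?_)) (.split₁₃ (.split₁₃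
    (.right ?_) (.left ?_)) (.split₂₃ (.left ?_) (.left ?_))))
  all_goals
    intro u v w hu hv hw
    simp only [negForm, radialForm, homHess, homHessX, homHessY, homXX, homXY, homYY, mid]
    ring_nf
    positivity

theorem cover_lower_below :
    CoverCone negForm (radialForm (3 / 5) (-4 / 5))
      (-3, -5 / 2, 1) (5 / 2, -5 / 2, 1) (5 / 2, -1 / 4, 1) := by
  refine .split₁₃ (.split₁₂ (.left ?_) (.split₂₃ (.split₁₂ (.right ?_) (.right ?_)) (.right ?_)))
    (.split₁₃ (.split₁₃ (.split₁₂ (.right ?_) (.split₂₃ (.right ?_) (.right ?_))) (.split₁₂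
    (.right ?_) (.right ?_))) (.left ?_))
  all_goals
    intro u v w hu hv hw
    simp only [negForm, radialForm, homHess, homHessX, homHessY, homXX, homXY, homYY, mid]
    ring_nf
    positivity

theorem cover_lower_above :
    CoverCone negForm (radialForm (3 / 5) (-4 / 5))
      (-3, -5 / 2, 1) (-3, -1 / 4, 1) (5 / 2, -1 / 4, 1) := by
  refine .split₁₃ (.left ?_) (.split₂₃ (.left ?_) (.split₁₃ (.split₁₃ (.right ?_) (.right ?_))
    (.split₂₃ (.split₁₂ (.right ?_) (.split₂₃ (.split₁₂ (.right ?_) (.split₂₃ (.left ?_) (.right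
    ?_))) (.right ?_))) (.left ?_))))
  all_goals
    intro u v w hu hv hw
    simp only [negForm, radialForm, homHess, homHessX, homHessY, homXX, homXY, homYY, mid]
    ring_nf
    positivity

theorem cover_upper_below :
    CoverCone negForm (radialForm 1 3) (-3, 5 / 4, 1) (5 / 2, 5 / 4, 1) (5 / 2, 8, 1) := by
  refine .split₁₃ (.split₁₃ (.split₁₃ (.split₁₂ (.split₁₂ (.split₁₂ (.split₁₃ (.left ?_) (.left
    ?_)) (.left ?_)) (.left ?_)) (.split₂₃ (.split₁₂ (.split₁₂ (.left ?_) (.right ?_)) (.right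
    ?_)) (.left ?_))) (.split₁₂ (.left ?_) (.right ?_))) (.split₂₃ (.right ?_) (.right ?_)))
    (.split₁₂ (.split₂₃ (.right ?_) (.right ?_)) (.right ?_))
  all_goals
    intro u v w hu hv hw
    simp only [negForm, radialForm, homHess, homHessX, homHessY, homXX, homXY, homYY, mid]
    ring_nf
    positivity

theorem cover_upper_above :
    CoverCone negForm (radialForm 1 3) (-3, 5 / 4, 1) (-3, 8, 1) (5 / 2, 8, 1) := by
  refine .split₁₃ (.split₁₂ (.split₁₃ (.split₁₂ (.split₁₃ (.split₁₂ (.split₁₃ (.left ?_) (.left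
    ?_)) (.left ?_)) (.left ?_)) (.left ?_)) (.left ?_)) (.left ?_)) (.split₂₃ (.left ?_) (.right
    ?_))
  all_goals
    intro u v w hu hv hw
    simp only [negForm, radialForm, homHess, homHessX, homHessY, homXX, homXY, homYY, mid]
    ring_nf
    positivity

theorem cover_right_line_up :
    CoverCone negForm negForm (5 / 2, 0, 1) (0, 1, 0) (0, 0, 0) := by
  refine .split₁₂ (.left ?_) (.split₁₂ (.left ?_) (.left ?_))
  all_goals
    intro u v w hu hv hw
    simp only [negForm, homHess, homXX, homXY, homYY, mid]
    ring_nf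
    positivity

theorem cover_right_line_down :
    CoverCone negForm negForm (5 / 2, 0, 1) (0, -1, 0) (0, 0, 0) := by
  refine .left ?_
  all_goals
    intro u v w hu hv hw
    simp only [negForm, homHess, homXX, homXY, homYY]
    ring_nf
    positivity

theorem cover_left_line_up :
    CoverCone negForm negForm (-3, 0, 1) (0, 1, 0) (0, 0, 0) := by
  refine .split₁₂ (.left ?_) (.split₁₂ (.split₁₂ (.left ?_) (.left ?_)) (.split₁₂ (.left ?_)
    (.left ?_)))
  all_goals
    intro u v w hu hv hw
    simp only [negForm, homHess, homXX, homXY, homYY, mid]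
    ring_nf
    positivity

theorem cover_left_line_down :
    CoverCone negForm negForm (-3, 0, 1) (0, -1, 0) (0, 0, 0) := by
  refine .left ?_
  all_goals
    intro u v w hu hv hw
    simp only [negForm, homHess, homXX, homXY, homYY]
    ring_nf
    positivity

theorem cover_lower_segment :
    CoverCone negForm negForm (-3, -1 / 4, 1) (5 / 2, -1 / 4, 1) (0, 0, 0) := by
  refine .split₁₂ (.left ?_) (.split₁₂ (.split₁₂ (.split₁₂ (.left ?_) (.split₁₂ (.split₁₂
    (.split₁₂ (.split₁₂ (.left ?_) (.left ?_)) (.left ?_)) (.left ?_)) (.left ?_))) (.left ?_))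
    (.left ?_))
  all_goals
    intro u v w hu hv hw
    simp only [negForm, homHess, homXX, homXY, homYY, mid]
    ring_nf
    positivity

theorem cover_upper_segment :
    CoverCone negForm negForm (-3, 5 / 4, 1) (5 / 2, 5 / 4, 1) (0, 0, 0) := by
  refine .split₁₂ (.split₁₂ (.left ?_) (.left ?_)) (.split₁₂ (.left ?_) (.left ?_))
  all_goals
    intro u v w hu hv hw
    simp only [negForm, homHess, homXX, homXY, homYY, mid]
    ring_nf
    positivity

theorem cover_top_strip :
    CoverCone negForm negForm (-3, 8, 1) (5 / 2, 8, 1) (0, 1, 0) := by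
  refine .split₁₂ (.left ?_) (.left ?_)
  all_goals
    intro u v w hu hv hw
    simp only [negForm, homHess, homXX, homXY, homYY, mid]
    ring_nf
    positivity

theorem cover_bottom_strip :
    CoverCone negForm negForm (-3, -5 / 2, 1) (5 / 2, -5 / 2, 1) (0, -1, 0) := by
  refine .split₁₂ (.left ?_) (.split₁₂ (.left ?_) (.left ?_))
  all_goals
    intro u v w hu hv hw
    simp only [negForm, homHess, homXX, homXY, homYY, mid]
    ring_nf
    positivity

theorem cover_left_halfplane_up :
    CoverCone negForm (shearForm 0) (-3, 0, 1) (-1, 3 / 10, 0) (0, 1, 0) := by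
  refine .split₁₃ (.right ?_) (.split₁₃ (.split₁₃ (.right ?_) (.right ?_)) (.split₁₃ (.right ?_)
    (.split₂₃ (.right ?_) (.left ?_))))
  all_goals
    intro u v w hu hv hw
    simp only [negForm, shearForm, homHess, homHessX, homHessY, homXX, homXY, homYY, mid]
    ring_nf
    positivity

theorem cover_left_halfplane_down :
    CoverCone negForm (shearForm 0) (-3, 0, 1) (-1, 3 / 10, 0) (0, -1, 0) := by
  refine .split₂₃ (.right ?_) (.left ?_)
  all_goals
    intro u v w hu hv hw
    simp only [negForm, shearForm, homHess, homHessX, homHessY, homXX, homXY, homYY, mid]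
    ring_nf
    positivity

theorem cover_right_halfplane_up :
    CoverCone negForm (shearForm (3 / 2)) (5 / 2, 0, 1) (1, -3 / 10, 0) (0, 1, 0) := by
  refine .split₁₃ (.right ?_) (.split₂₃ (.split₁₃ (.right ?_) (.right ?_)) (.split₁₂ (.split₁₃
    (.left ?_) (.left ?_)) (.left ?_)))
  all_goals
    intro u v w hu hv hw
    simp only [negForm, shearForm, homHess, homHessX, homHessY, homXX, homXY, homYY, mid]
    ring_nf
    positivity

theorem cover_right_halfplane_down :
    CoverCone negForm (shearForm (3 / 2)) (5 / 2, 0, 1) (1, -3 / 10, 0) (0, -1, 0) := by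
  refine .split₁₃ (.right ?_) (.split₂₃ (.right ?_) (.split₁₃ (.right ?_) (.left ?_)))
  all_goals
    intro u v w hu hv hw
    simp only [negForm, shearForm, homHess, homHessX, homHessY, homXX, homXY, homYY, mid]
    ring_nf
    positivity

/-! ### The derivative of the hessian -/

theorem hasFDerivAt_quadratic (a b c d e g : ℝ) (q : ℝ × ℝ) :
    HasFDerivAt
      (fun q : ℝ × ℝ => a + b * q.1 + c * q.2 + d * q.1 ^ 2 + e * (q.1 * q.2) + g * q.2 ^ 2)
      ((b + 2 * d * q.1 + e * q.2) • ContinuousLinearMap.fst ℝ ℝ ℝ +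
        (c + e * q.1 + 2 * g * q.2) • ContinuousLinearMap.snd ℝ ℝ ℝ) q := by
  have h₁ : HasFDerivAt (fun q : ℝ × ℝ => q.1) (ContinuousLinearMap.fst ℝ ℝ ℝ) q := hasFDerivAt_fst
  have h₂ : HasFDerivAt (fun q : ℝ × ℝ => q.2) (ContinuousLinearMap.snd ℝ ℝ ℝ) q := hasFDerivAt_snd
  refine ((((((hasFDerivAt_const a q).add (h₁.const_mul b)).add (h₂.const_mul c)).add
    ((h₁.pow 2).const_mul d)).add ((h₁.mul h₂).const_mul e)).add
    ((h₂.pow 2).const_mul g)).congr_fderiv ?_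
  ext <;> simp <;> ring

theorem hasFDerivAt_homHess (q : ℝ × ℝ) :
    HasFDerivAt (fun q : ℝ × ℝ => homHess q.1 q.2 1)
      (homHessX q.1 q.2 1 • ContinuousLinearMap.fst ℝ ℝ ℝ +
        homHessY q.1 q.2 1 • ContinuousLinearMap.snd ℝ ℝ ℝ) q := by
  have hXX := hasFDerivAt_quadratic 44 (-480) (-20) 180 24 (-6) q
  have hYY := hasFDerivAt_quadratic 48 142 234 (-6) (-126) (-204) q
  have hXY := hasFDerivAt_quadratic 36 (-20) 142 12 (-12) (-63) q
  refine (((hXX.mul hYY).sub (hXY.pow 2)).congr_fderiv ?_).congr_of_eventuallyEq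
    (.of_forall fun q => ?_)
  · ext <;> simp [homHessX, homHessY, homXX, homYY, homXY] <;> ring
  · simp [homHess, homXX, homYY, homXY]; ring

theorem pderiv_ofNat {R σ : Type*} [CommSemiring R] (i : σ) (n : ℕ) [n.AtLeastTwo] :
    pderiv i (ofNat(n) : MvPolynomial σ R) = 0 :=
  (pderiv i).map_natCast n

theorem pderiv_zero_f : pderiv 0 f =
    44 * X 0 + 36 * X 1 - 240 * X 0 ^ 2 - 20 * (X 0 * X 1) + 71 * X 1 ^ 2 + 60 * X 0 ^ 3
      + 12 * (X 0 ^ 2 * X 1) - 6 * (X 0 * X 1 ^ 2) - 21 * X 1 ^ 3 := by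
  simp only [f, map_add, map_sub, Derivation.leibniz, Derivation.leibniz_pow,
    pderiv_ofNat, pderiv_X_self, pderiv_X_of_ne one_ne_zero, smul_eq_mul, nsmul_eq_mul]
  push_cast
  ring

theorem pderiv_one_f : pderiv 1 f =
    36 * X 0 + 48 * X 1 - 10 * X 0 ^ 2 + 142 * (X 0 * X 1) + 117 * X 1 ^ 2 + 4 * X 0 ^ 3
      - 6 * (X 0 ^ 2 * X 1) - 63 * (X 0 * X 1 ^ 2) - 68 * X 1 ^ 3 := by
  simp only [f, map_add, map_sub, Derivation.leibniz, Derivation.leibniz_pow,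
    pderiv_ofNat, pderiv_X_self, pderiv_X_of_ne zero_ne_one, smul_eq_mul, nsmul_eq_mul]
  push_cast
  ring

theorem mem_Z_iff (q : ℝ × ℝ) : q ∈ Z ↔ homHess q.1 q.2 1 = 0 := by
  have h : eval ![q.1, q.2] (Hess f) = homHess q.1 q.2 1 := by
    simp only [Hess, pderiv_zero_f, pderiv_one_f, map_add, map_sub, Derivation.leibniz,
      Derivation.leibniz_pow, pderiv_ofNat, pderiv_X_self, pderiv_X_of_ne zero_ne_one,
      pderiv_X_of_ne one_ne_zero, smul_eq_mul, nsmul_eq_mul]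
    simp only [map_add, map_sub, map_mul, map_pow, map_ofNat, map_zero, map_one, map_natCast,
      eval_X, Matrix.cons_val_zero, Matrix.cons_val_one, homHess, homXX, homYY, homXY]
    push_cast
    ring
  rw [← h]
  rfl

/-! ### Counting components -/

/-- If disjoint open sets cover `Z` and each of them meets `Z` in a connected set, then these
intersections are the connected components of `Z`. -/
theorem components_eq_range {ι : Type*} {Z : Set (ℝ × ℝ)} {U : ι → Set (ℝ × ℝ)}
    (hU : ∀ i, IsOpen (U i)) (hdisj : Pairwise (Function.onFun Disjoint U)) (hZ : Z ⊆ ⋃ i, U i)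
    (hconn : ∀ i, IsConnected (U i ∩ Z)) : components Z = range fun i => U i ∩ Z := by
  have key : ∀ i, ∀ p ∈ U i ∩ Z, connectedComponentIn Z p = U i ∩ Z := by
    intro i p hp
    refine Subset.antisymm (subset_inter ?_ (connectedComponentIn_subset Z p))
      ((hconn i).isPreconnected.subset_connectedComponentIn hp inter_subset_right)
    refine isPreconnected_connectedComponentIn.subset_left_of_subset_union (hU i)
      (isOpen_iUnion fun j => isOpen_iUnion fun _ : j ≠ i => hU j) ?_ ?_
      ⟨p, mem_connectedComponentIn hp.2, hp.1⟩
    · simp only [disjoint_iUnion_right]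
      exact fun j hj => hdisj hj.symm
    · intro q hq
      obtain ⟨j, hj⟩ := mem_iUnion.1 (hZ (connectedComponentIn_subset Z p hq))
      by_cases hji : j = i
      · exact .inl (hji ▸ hj)
      · exact .inr (mem_biUnion (show j ∈ {j | j ≠ i} from hji) hj)
  ext C
  constructor
  · rintro ⟨p, hp, rfl⟩
    obtain ⟨i, hi⟩ := mem_iUnion.1 (hZ hp)
    exact ⟨i, (key i p ⟨hi, hp⟩).symm⟩
  · rintro ⟨i, rfl⟩
    obtain ⟨p, hp⟩ := (hconn i).nonempty
    exact ⟨p, hp.2, (key i p hp).symm⟩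

theorem injective_inter_of_pairwise_disjoint {α ι : Type*} {Z : Set α} {U : ι → Set α}
    (hdisj : Pairwise (Function.onFun Disjoint U)) (hne : ∀ i, (U i ∩ Z).Nonempty) :
    Function.Injective fun i => U i ∩ Z := by
  intro i j hij
  by_contra hne'
  obtain ⟨p, hp⟩ := hne i
  have hp' : p ∈ U j ∩ Z := by rw [← show U i ∩ Z = U j ∩ Z from hij]; exact hp
  exact disjoint_left.1 (hdisj hne') hp.1 hp'.1

/-! ### The five pieces of the hessian curve -/

theorem homHess_mul (t x y z : ℝ) :
    homHess (t * x) (t * y) (t * z) = t ^ 4 * homHess x y z := by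
  simp only [homHess, homXX, homYY, homXY]
  ring

theorem homHess_neg_of_negForm {x y : ℝ} (h : 0 ≤ negForm x y 1) : homHess x y 1 < 0 := by
  simp only [negForm] at h
  linarith

theorem homHess_neg_of_cover {x y : ℝ} (h : 0 ≤ negForm x y 1 ∨ 0 ≤ negForm x y 1) :
    homHess x y 1 < 0 :=
  homHess_neg_of_negForm (or_self_iff.1 h)

/-- A rectangle whose boundary avoids the hessian curve and on which the radial derivative has a
sign along the curve contains exactly one oval. -/
theorem isConnected_box_inter_Z {x₁ x₂ y₁ y₂ p q : ℝ} (hp : p ∈ Ioo x₁ x₂) (hq : q ∈ Ioo y₁ y₂)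
    (hpos : 0 < homHess p q 1) (hleft : ∀ y, homHess x₁ y 1 < 0) (hright : ∀ y, homHess x₂ y 1 < 0)
    (hbottom : ∀ x ∈ Icc x₁ x₂, homHess x y₁ 1 < 0) (htop : ∀ x ∈ Icc x₁ x₂, homHess x y₂ 1 < 0)
    (h₁ : CoverCone negForm (radialForm p q) (x₁, y₁, 1) (x₂, y₁, 1) (x₂, y₂, 1))
    (h₂ : CoverCone negForm (radialForm p q) (x₁, y₁, 1) (x₁, y₂, 1) (x₂, y₂, 1)) :
    IsConnected (Ioo x₁ x₂ ×ˢ Ioo y₁ y₂ ∩ Z) := by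
  have hint : interior (Icc x₁ x₂ ×ˢ Icc y₁ y₂) = Ioo x₁ x₂ ×ˢ Ioo y₁ y₂ := by
    rw [interior_prod_eq, interior_Icc, interior_Icc]
  have hset : Ioo x₁ x₂ ×ˢ Ioo y₁ y₂ ∩ Z =
      {z | z ∈ interior (Icc x₁ x₂ ×ˢ Icc y₁ y₂) ∧ homHess z.1 z.2 1 = 0} := by
    ext z
    rw [hint, mem_inter_iff, mem_Z_iff, mem_ofPred_eq]
  rw [hset]
  refine isConnected_zeros_of_radial hasFDerivAt_homHess ((convex_Icc _ _).prod (convex_Icc _ _))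
    (isCompact_Icc.prod isCompact_Icc) (p := (p, q)) (by rw [hint]; exact ⟨hp, hq⟩) hpos ?_ ?_
  · rintro ⟨x, y⟩ ⟨hx, hy⟩ hxy
    rw [hint] at hxy
    rcases eq_or_lt_of_le hx.1 with rfl | hx1
    · exact hleft y
    rcases eq_or_lt_of_le hx.2 with rfl | hx2
    · exact hright y
    rcases eq_or_lt_of_le hy.1 with rfl | hy1
    · exact hbottom x hx
    rcases eq_or_lt_of_le hy.2 with rfl | hy2
    · exact htop x hx
    exact absurd ⟨⟨hx1, hx2⟩, hy1, hy2⟩ hxy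
  · rintro ⟨x, y⟩ ⟨hx, hy⟩ h0
    rcases CoverCone.of_rectangle (hp.1.trans hp.2) (hq.1.trans hq.2) h₁ h₂ hx hy with h | h
    · exact absurd h0 (homHess_neg_of_negForm h).ne
    · simp only [radialForm] at h
      simp only [Prod.mk_sub_mk, _root_.add_apply, _root_.smul_apply,
        ContinuousLinearMap.coe_fst', ContinuousLinearMap.coe_snd', smul_eq_mul] at h0 ⊢
      linarith

/-- A half-plane whose boundary avoids the hessian curve and on which the derivative in the
direction `(1, -3 / 10)` has a sign along the curve contains exactly one unbounded branch. -/
theorem isConnected_halfplane_inter_Z {σ m x₀ c : ℝ} (hσ : σ * σ = 1) (hm : m = -3 / 10 * σ)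
    (hc : 0 < σ * (x₀ - c)) (hline : ∀ y, homHess x₀ y 1 < 0)
    (h₁ : CoverCone negForm (shearForm c) (x₀, 0, 1) (σ, m, 0) (0, 1, 0))
    (h₂ : CoverCone negForm (shearForm c) (x₀, 0, 1) (σ, m, 0) (0, -1, 0)) :
    IsConnected ({q : ℝ × ℝ | 0 < σ * (q.1 - x₀)} ∩ Z) ∧
      ¬ Bornology.IsBounded ({q : ℝ × ℝ | 0 < σ * (q.1 - x₀)} ∩ Z) := by
  have hset : {q : ℝ × ℝ | 0 < σ * (q.1 - x₀)} ∩ Z =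
      {q : ℝ × ℝ | 0 < σ * (q.1 - x₀) ∧ homHess q.1 q.2 1 = 0} := by
    ext q
    rw [mem_inter_iff, mem_Z_iff, mem_ofPred_eq, mem_ofPred_eq]
  rw [hset]
  refine isConnected_zeros_of_parallel hasFDerivAt_homHess (m := m) hσ hline (fun y => ?_) ?_
  · have hcont : Continuous fun ε : ℝ => homHess (σ + ε * x₀) (m + ε * y) ε := by
      unfold homHess homXX homYY homXY
      fun_prop
    have hlim : 0 < homHess (σ + 0 * x₀) (m + 0 * y) 0 := by
      have : homHess (σ + 0 * x₀) (m + 0 * y) 0 = σ ^ 4 * homHess 1 (-3 / 10) 0 := by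
        rw [← homHess_mul, hm]
        ring_nf
      rw [this, show σ ^ 4 = (σ * σ) * (σ * σ) by ring, hσ]
      norm_num [homHess, homXX, homYY, homXY]
    obtain ⟨ε, hε, hε0⟩ := (((hcont.continuousAt (x := 0)).eventually_const_lt hlim).filter_mono
      nhdsWithin_le_nhds |>.and (self_mem_nhdsWithin (s := Ioi (0 : ℝ)))).exists
    refine ⟨ε⁻¹, by positivity, ?_⟩
    have : homHess (x₀ + σ * ε⁻¹) (y + m * ε⁻¹) 1 =
        ε⁻¹ ^ 4 * homHess (σ + ε * x₀) (m + ε * y) ε := by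
      rw [← homHess_mul]
      congr 1 <;> field_simp <;> ring
    simp only [this]
    positivity
  · rintro ⟨x, y⟩ hx h0
    rcases CoverCone.of_halfplane hσ h₁ h₂ (y := y) hx with h | h
    · exact absurd h0 (homHess_neg_of_negForm h).ne
    · simp only [shearForm] at h
      simp only [_root_.add_apply, _root_.smul_apply,
        ContinuousLinearMap.coe_fst', ContinuousLinearMap.coe_snd', smul_eq_mul] at h0 hx ⊢
      refine pos_of_mul_pos_right (b := homHessX x y 1 * σ + homHessY x y 1 * m)
        (a := σ * (x - c)) ?_ (by linarith)
      have : σ * (x - c) * (homHessX x y 1 * σ + homHessY x y 1 * m) =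
          (x - c) * (homHessX x y 1 - 3 / 10 * homHessY x y 1) := by
        rw [hm]
        linear_combination (x - c) * (homHessX x y 1 - 3 / 10 * homHessY x y 1) * hσ
      rw [this]
      linarith

theorem homHess_neg_left (y : ℝ) : homHess (-3) y 1 < 0 :=
  homHess_neg_of_cover (CoverCone.of_line cover_left_line_up cover_left_line_down y)

theorem homHess_neg_right (y : ℝ) : homHess (5 / 2) y 1 < 0 :=
  homHess_neg_of_cover (CoverCone.of_line cover_right_line_up cover_right_line_down y)

theorem homHess_neg_lower_segment {x : ℝ} (hx : x ∈ Icc (-3 : ℝ) (5 / 2)) :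
    homHess x (-1 / 4) 1 < 0 :=
  homHess_neg_of_cover (CoverCone.of_segment (by norm_num) cover_lower_segment hx)

theorem homHess_neg_upper_segment {x : ℝ} (hx : x ∈ Icc (-3 : ℝ) (5 / 2)) :
    homHess x (5 / 4) 1 < 0 :=
  homHess_neg_of_cover (CoverCone.of_segment (by norm_num) cover_upper_segment hx)

theorem homHess_neg_top_strip {x y : ℝ} (hx : x ∈ Icc (-3 : ℝ) (5 / 2)) (hy : 8 ≤ y) :
    homHess x y 1 < 0 :=
  homHess_neg_of_cover
    (CoverCone.of_strip (by norm_num) (by norm_num) cover_top_strip hx (by linarith))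

theorem homHess_neg_bottom_strip {x y : ℝ} (hx : x ∈ Icc (-3 : ℝ) (5 / 2)) (hy : y ≤ -5 / 2) :
    homHess x y 1 < 0 :=
  homHess_neg_of_cover
    (CoverCone.of_strip (by norm_num) (by norm_num) cover_bottom_strip hx (by linarith))

/-- Three rectangles and two half-planes separating the components of the hessian curve. -/
def region : Fin 5 → Set (ℝ × ℝ) :=
  ![Ioo (-3) (5 / 2) ×ˢ Ioo (-1 / 4) (5 / 4), Ioo (-3) (5 / 2) ×ˢ Ioo (-5 / 2) (-1 / 4),
    Ioo (-3) (5 / 2) ×ˢ Ioo (5 / 4) 8, {q | 0 < -1 * (q.1 - -3)}, {q | 0 < 1 * (q.1 - 5 / 2)}]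

theorem isOpen_region (i : Fin 5) : IsOpen (region i) := by
  have hσ : ∀ σ x₀ : ℝ, IsOpen {q : ℝ × ℝ | 0 < σ * (q.1 - x₀)} := fun σ x₀ =>
    isOpen_lt continuous_const (by fun_prop)
  fin_cases i
  exacts [isOpen_Ioo.prod isOpen_Ioo, isOpen_Ioo.prod isOpen_Ioo, isOpen_Ioo.prod isOpen_Ioo,
    hσ _ _, hσ _ _]

theorem pairwise_disjoint_region : Pairwise (Function.onFun Disjoint region) := by
  intro i j hij
  refine disjoint_left.2 ?_
  rintro ⟨x, y⟩ hi hj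
  fin_cases i <;> fin_cases j <;> first | exact hij rfl | skip
  all_goals
    simp [region] at hi hj
    linarith

theorem Z_subset_iUnion_region : Z ⊆ ⋃ i, region i := by
  rintro ⟨x, y⟩ hxy
  replace hxy : homHess x y 1 = 0 := (mem_Z_iff _).1 hxy
  rw [mem_iUnion]
  rcases lt_trichotomy x (-3) with hl | rfl | hl
  · exact ⟨3, show 0 < -1 * (x - -3) by linarith⟩
  · exact absurd hxy (homHess_neg_left y).ne
  rcases lt_trichotomy x (5 / 2) with hr | rfl | hr
  rotate_left
  · exact absurd hxy (homHess_neg_right y).ne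
  · exact ⟨4, show 0 < 1 * (x - 5 / 2) by linarith⟩
  have hx : x ∈ Icc (-3 : ℝ) (5 / 2) := ⟨hl.le, hr.le⟩
  rcases le_or_gt y (-5 / 2) with h | h₀
  · exact absurd hxy (homHess_neg_bottom_strip hx h).ne
  rcases lt_trichotomy y (-1 / 4) with h | rfl | h₁
  · exact ⟨1, ⟨hl, hr⟩, h₀, h⟩
  · exact absurd hxy (homHess_neg_lower_segment hx).ne
  rcases lt_trichotomy y (5 / 4) with h | rfl | h₂
  · exact ⟨0, ⟨hl, hr⟩, h₁, h⟩
  · exact absurd hxy (homHess_neg_upper_segment hx).ne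
  rcases lt_or_ge y 8 with h | h₃
  · exact ⟨2, ⟨hl, hr⟩, h₂, h⟩
  · exact absurd hxy (homHess_neg_top_strip hx h₃).ne

theorem isConnected_left_branch :
    IsConnected (region 3 ∩ Z) ∧ ¬ Bornology.IsBounded (region 3 ∩ Z) :=
  isConnected_halfplane_inter_Z (by norm_num) (by norm_num) (by norm_num) homHess_neg_left
    cover_left_halfplane_up cover_left_halfplane_down

theorem isConnected_right_branch :
    IsConnected (region 4 ∩ Z) ∧ ¬ Bornology.IsBounded (region 4 ∩ Z) :=
  isConnected_halfplane_inter_Z (by norm_num) (by norm_num) (by norm_num) homHess_neg_right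
    cover_right_halfplane_up cover_right_halfplane_down

theorem isConnected_region_inter_Z (i : Fin 5) : IsConnected (region i ∩ Z) := by
  fin_cases i
  · exact isConnected_box_inter_Z (p := -3 / 5) (q := 3 / 5) (by norm_num) (by norm_num)
      (by norm_num [homHess, homXX, homYY, homXY]) homHess_neg_left homHess_neg_right
      (fun _ => homHess_neg_lower_segment) (fun _ => homHess_neg_upper_segment)
      cover_middle_below cover_middle_above
  · exact isConnected_box_inter_Z (p := 3 / 5) (q := -4 / 5) (by norm_num) (by norm_num)
      (by norm_num [homHess, homXX, homYY, homXY]) homHess_neg_left homHess_neg_right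
      (fun _ hx => homHess_neg_bottom_strip hx le_rfl) (fun _ => homHess_neg_lower_segment)
      cover_lower_below cover_lower_above
  · exact isConnected_box_inter_Z (p := 1) (q := 3) (by norm_num) (by norm_num)
      (by norm_num [homHess, homXX, homYY, homXY]) homHess_neg_left homHess_neg_right
      (fun _ => homHess_neg_upper_segment) (fun _ hx => homHess_neg_top_strip hx le_rfl)
      cover_upper_below cover_upper_above
  · exact isConnected_left_branch.1
  · exact isConnected_right_branch.1

theorem isBounded_region_inter_Z_iff (i : Fin 5) :
    Bornology.IsBounded (region i ∩ Z) ↔ i ∈ ({0, 1, 2} : Finset (Fin 5)) := by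
  have hbox : ∀ a b c d : ℝ, Bornology.IsBounded (Ioo a b ×ˢ Ioo c d ∩ Z) := fun a b c d =>
    ((Metric.isBounded_Ioo a b).prod (Metric.isBounded_Ioo c d)).subset inter_subset_left
  fin_cases i
  · exact iff_of_true (hbox _ _ _ _) (by decide)
  · exact iff_of_true (hbox _ _ _ _) (by decide)
  · exact iff_of_true (hbox _ _ _ _) (by decide)
  · exact iff_of_false isConnected_left_branch.2 (by decide)
  · exact iff_of_false isConnected_right_branch.2 (by decide)

end HessianCurve

end

open HessianCurve in
/-- The hessian curve of `f` has exactly 5 connected components: 3 bounded (ovals)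
and 2 unbounded. -/
theorem hessian_curve_components :
    (components Z).ncard = 5 ∧
    {C ∈ components Z | Bornology.IsBounded C}.ncard = 3 ∧
    {C ∈ components Z | ¬ Bornology.IsBounded C}.ncard = 2 := by
  have hinj := injective_inter_of_pairwise_disjoint pairwise_disjoint_region
    fun i => (isConnected_region_inter_Z i).nonempty
  have hcomp := components_eq_range isOpen_region pairwise_disjoint_region Z_subset_iUnion_region
    isConnected_region_inter_Z
  have hcount : ∀ (P : Set (ℝ × ℝ) → Prop) (s : Finset (Fin 5)),
      (∀ i, P (region i ∩ Z) ↔ i ∈ s) → {C ∈ components Z | P C}.ncard = s.card := by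
    intro P s hP
    have : {C ∈ components Z | P C} = (fun i => region i ∩ Z) '' s := by
      ext C
      rw [hcomp]
      constructor
      · rintro ⟨⟨i, rfl⟩, hi⟩
        exact ⟨i, (hP i).1 hi, rfl⟩
      · rintro ⟨i, hi, rfl⟩
        exact ⟨⟨i, rfl⟩, (hP i).2 hi⟩
    rw [this, ncard_image_of_injective _ hinj, ncard_coe_finset]
  refine ⟨?_, hcount _ {0, 1, 2} isBounded_region_inter_Z_iff, hcount _ {3, 4} fun i => ?_⟩
  · simpa using hcount (fun _ => True) Finset.univ (by simp)
  · rw [isBounded_region_inter_Z_iff]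
    revert i
    decide
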